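/- For all positive integers k and n, one has the inequality k·n + f(k·n, k·n) ≤ k²·n + f(n, k²·n). -/

import Mathlib

open Real

/-- `f n m` is the least nonnegative integer `L` such that the interval `(m, m + L]`
contains `n` distinct integers `a 1, ..., a n` with `i ∣ a i` for all `1 ≤ i ≤ n`. -/
noncomputable def f (n m : ℕ) : ℕ :=
  sInf {L : ℕ | ∃ a : ℕ → ℕ,
    (∀ i ∈ Finset.Icc 1 n, i ∣ a i) ∧
    (∀ i ∈ Finset.Icc 1 n, m < a i ∧ a i ≤ m + L) ∧
    Set.InjOn a (Finset.Icc 1 n)}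

/-- The set of admissible lengths defining `f n m` is nonempty, so its infimum is attained. -/
theorem exists_distinct_multiples_f (n m : ℕ) : ∃ a : ℕ → ℕ,
    (∀ i ∈ Finset.Icc 1 n, i ∣ a i) ∧
    (∀ i ∈ Finset.Icc 1 n, m < a i ∧ a i ≤ m + f n m) ∧
    Set.InjOn a (Finset.Icc 1 n) := by
  refine Nat.sInf_mem (s := {L : ℕ | ∃ a : ℕ → ℕ,
    (∀ i ∈ Finset.Icc 1 n, i ∣ a i) ∧
    (∀ i ∈ Finset.Icc 1 n, m < a i ∧ a i ≤ m + L) ∧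
    Set.InjOn a (Finset.Icc 1 n)}) ⟨n * (m + 1), fun i => i * (m + 1), ?_, ?_, ?_⟩
  · exact fun i _ => dvd_mul_right _ _
  · intro i hi
    rw [Finset.mem_Icc] at hi
    have h₁ : 1 * (m + 1) ≤ i * (m + 1) := Nat.mul_le_mul_right _ hi.1
    have h₂ : i * (m + 1) ≤ n * (m + 1) := Nat.mul_le_mul_right _ hi.2
    constructor <;> dsimp only <;> omega
  · exact fun i _ j _ h => Nat.eq_of_mul_eq_mul_right m.succ_pos h

theorem stmt_2 : ∀ k n : ℕ, 0 < k → 0 < n →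
    k * n + f (k * n) (k * n) ≤ k ^ 2 * n + f n (k ^ 2 * n) := by
  intro k n hk _
  obtain ⟨a, hdvd, hmem, hinj⟩ := exists_distinct_multiples_f n (k ^ 2 * n)
  have hkn : k * n ≤ k ^ 2 * n := Nat.mul_le_mul_right _ (Nat.le_self_pow two_ne_zero k)
  have hlow : ∀ i, n < i → k * n < k * i := fun i hi => Nat.mul_lt_mul_of_pos_left hi hk
  have hhigh : ∀ i, i ≤ k * n → k * i ≤ k ^ 2 * n := fun i hi =>
    (Nat.mul_le_mul_left k hi).trans_eq (by ring)
  suffices h : f (k * n) (k * n) ≤ k ^ 2 * n + f n (k ^ 2 * n) - k * n by omega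
  -- Keep `a i` for `i ≤ n`, and use `k * i`, which is at most `k ^ 2 * n`, for `n < i ≤ k * n`.
  refine Nat.sInf_le ⟨fun i => if i ≤ n then a i else k * i, ?_, ?_, ?_⟩
  · intro i hi
    rw [Finset.mem_Icc] at hi
    dsimp only
    split_ifs with h
    · exact hdvd i (Finset.mem_Icc.2 ⟨hi.1, h⟩)
    · exact dvd_mul_left _ _
  · intro i hi
    rw [Finset.mem_Icc] at hi
    dsimp only
    split_ifs with h
    · have := hmem i (Finset.mem_Icc.2 ⟨hi.1, h⟩)
      omega
    · have := hlow i (not_le.1 h)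
      have := hhigh i hi.2
      omega
  · intro i hi j hj hij
    rw [Finset.mem_coe, Finset.mem_Icc] at hi hj
    dsimp only at hij
    split_ifs at hij with h₁ h₂ h₂
    · exact hinj (Finset.mem_coe.2 (Finset.mem_Icc.2 ⟨hi.1, h₁⟩))
        (Finset.mem_coe.2 (Finset.mem_Icc.2 ⟨hj.1, h₂⟩)) hij
    · have := hmem i (Finset.mem_Icc.2 ⟨hi.1, h₁⟩)
      have := hhigh j hj.2
      omega
    · have := hmem j (Finset.mem_Icc.2 ⟨hj.1, h₂⟩)
      have := hhigh i hi.2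
      omega
    · exact Nat.eq_of_mul_eq_mul_left hk hij
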